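/- Let (w_0,w_1) be positive weight functions on the edges of ℤ₊², let n ≥ 1, let 0 ≤ h' ≤ h ≤ n, let 1 ≤ m ≤ n and k ∈ ℕ. For a standard path γ of length n, let H_m(γ) denote the number of head steps among the first m steps of γ. Then (Σ_{γ ending at (h,n−h), H_m(γ) ≥ k} w(γ)) · d(h',n−h') ≥ (Σ_{γ ending at (h',n−h'), H_m(γ) ≥ k} w(γ)) · d(h,n−h); in other words, the elementary measure obtained by normalizing path weights to the endpoint (h,n−h) stochastically dominates, in the number of heads among the first m steps, the elementary measure to the endpoint (h',n−h'). -/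

import Mathlib

open Finset

/-- Number of head steps (`true` increments) among the first `m` steps of the path `γ`. -/
def headsUpTo {n : ℕ} (γ : Fin n → Bool) (m : ℕ) : ℕ :=
  ((Finset.univ : Finset (Fin n)).filter (fun i => i.val < m ∧ γ i = true)).card

/-- The weight of a standard path: the product over steps of the weight of the traversed edge,
where the position before step `i` is `(h_i, i - h_i)` with `h_i` the number of heads so far. -/
def pathWeight (w0 w1 : ℕ × ℕ → ℝ) {n : ℕ} (γ : Fin n → Bool) : ℝ :=
  ∏ i : Fin n,
    (if γ i then w1 (headsUpTo γ i.val, i.val - headsUpTo γ i.val)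
     else w0 (headsUpTo γ i.val, i.val - headsUpTo γ i.val))

/-- The dimension `d(h,t)`: the total weight of all standard paths from `(0,0)` to `(h,t)`. -/
def dim (w0 w1 : ℕ × ℕ → ℝ) (h t : ℕ) : ℝ :=
  ∑ γ ∈ (Finset.univ : Finset (Fin (h + t) → Bool)).filter (fun γ => headsUpTo γ (h + t) = h),
    pathWeight w0 w1 γ

/-- The total weight of the paths of length `n` with `h` heads, of which at least `k` occur among
the first `m` steps. -/
def restrictedDim (w0 w1 : ℕ × ℕ → ℝ) (m k n h : ℕ) : ℝ :=
  ∑ γ ∈ (Finset.univ : Finset (Fin n → Bool)).filter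
    (fun γ => headsUpTo γ n = h ∧ k ≤ headsUpTo γ m), pathWeight w0 w1 γ

theorem headsUpTo_eq_sum {n : ℕ} (γ : Fin n → Bool) (m : ℕ) :
    headsUpTo γ m = ∑ i : Fin n, if i.val < m ∧ γ i = true then 1 else 0 := by
  rw [headsUpTo, Finset.card_filter]

theorem headsUpTo_snoc_of_le {n m : ℕ} (γ : Fin n → Bool) (b : Bool) (hm : m ≤ n) :
    headsUpTo (Fin.snoc γ b : Fin (n + 1) → Bool) m = headsUpTo γ m := by
  simp only [headsUpTo_eq_sum, Fin.sum_univ_castSucc, Fin.snoc_castSucc, Fin.val_castSucc,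
    Fin.val_last, Nat.not_lt.mpr hm, false_and, if_false, add_zero]

theorem headsUpTo_snoc_succ {n : ℕ} (γ : Fin n → Bool) (b : Bool) :
    headsUpTo (Fin.snoc γ b : Fin (n + 1) → Bool) (n + 1) =
      headsUpTo γ n + if b = true then 1 else 0 := by
  simp only [headsUpTo_eq_sum, Fin.sum_univ_castSucc, Fin.snoc_castSucc, Fin.snoc_last,
    Fin.is_lt, true_and]

theorem pathWeight_snoc (w0 w1 : ℕ × ℕ → ℝ) {n : ℕ} (γ : Fin n → Bool) (b : Bool) :
    pathWeight w0 w1 (Fin.snoc γ b : Fin (n + 1) → Bool) = pathWeight w0 w1 γ *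
      if b then w1 (headsUpTo γ n, n - headsUpTo γ n)
      else w0 (headsUpTo γ n, n - headsUpTo γ n) := by
  simp [pathWeight, Fin.prod_univ_castSucc, headsUpTo_snoc_of_le, Fin.is_le']

theorem sum_snoc_bool {n : ℕ} (f : (Fin (n + 1) → Bool) → ℝ) :
    ∑ γ, f γ = ∑ γ : Fin n → Bool, (f (Fin.snoc γ true) + f (Fin.snoc γ false)) := by
  rw [← (Fin.snocEquiv (fun _ : Fin (n + 1) => Bool)).sum_comp, Fintype.sum_prod_type,
    Fintype.sum_bool, ← Finset.sum_add_distrib]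
  rfl

theorem restrictedDim_succ_zero (w0 w1 : ℕ × ℕ → ℝ) {m n : ℕ} (k : ℕ) (hm : m ≤ n) :
    restrictedDim w0 w1 m k (n + 1) 0 = restrictedDim w0 w1 m k n 0 * w0 (0, n) := by
  simp only [restrictedDim, Finset.sum_filter, sum_snoc_bool, Finset.sum_mul]
  refine Finset.sum_congr rfl fun γ _ => ?_
  simp only [headsUpTo_snoc_succ, headsUpTo_snoc_of_le _ _ hm, pathWeight_snoc]
  by_cases h : headsUpTo γ n = 0 <;> simp [h]

theorem restrictedDim_succ_succ (w0 w1 : ℕ × ℕ → ℝ) {m n : ℕ} (k h : ℕ) (hm : m ≤ n) :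
    restrictedDim w0 w1 m k (n + 1) (h + 1) =
      restrictedDim w0 w1 m k n h * w1 (h, n - h) +
        restrictedDim w0 w1 m k n (h + 1) * w0 (h + 1, n - (h + 1)) := by
  simp only [restrictedDim, Finset.sum_filter, sum_snoc_bool, Finset.sum_mul,
    ← Finset.sum_add_distrib]
  refine Finset.sum_congr rfl fun γ _ => ?_
  simp only [headsUpTo_snoc_succ, headsUpTo_snoc_of_le _ _ hm, pathWeight_snoc]
  by_cases h1 : headsUpTo γ n = h
  · simp [h1]
  · by_cases h2 : headsUpTo γ n = h + 1 <;> simp [h1, h2]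

theorem restrictedDim_nonneg {w0 w1 : ℕ × ℕ → ℝ} (hw0 : ∀ p, 0 ≤ w0 p) (hw1 : ∀ p, 0 ≤ w1 p)
    (m k n h : ℕ) : 0 ≤ restrictedDim w0 w1 m k n h := by
  refine Finset.sum_nonneg fun γ _ => Finset.prod_nonneg fun i _ => ?_
  split_ifs
  exacts [hw1 _, hw0 _]

theorem restrictedDim_self (w0 w1 : ℕ × ℕ → ℝ) (m k h : ℕ) :
    restrictedDim w0 w1 m k m h = if k ≤ h then restrictedDim w0 w1 m 0 m h else 0 := by
  simp only [restrictedDim]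
  split_ifs with hk
  · congr 1
    ext γ
    simp only [Finset.mem_filter]
    grind
  · rw [Finset.filter_false_of_mem (by grind), Finset.sum_empty]

theorem dim_eq_restrictedDim (w0 w1 : ℕ × ℕ → ℝ) (m : ℕ) {n h : ℕ} (hn : h ≤ n) :
    dim w0 w1 h (n - h) = restrictedDim w0 w1 m 0 n h := by
  obtain ⟨t, rfl⟩ := Nat.exists_eq_add_of_le hn
  rw [Nat.add_sub_cancel_left, dim, restrictedDim]
  exact Finset.sum_congr (by ext; simp) fun _ _ => rfl

theorem restrictedDim_mul_le {w0 w1 : ℕ × ℕ → ℝ} (hw0 : ∀ p, 0 ≤ w0 p) (hw1 : ∀ p, 0 ≤ w1 p)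
    (m k : ℕ) {n : ℕ} (hmn : m ≤ n) {h h' : ℕ} (hh : h' ≤ h) :
    restrictedDim w0 w1 m k n h' * restrictedDim w0 w1 m 0 n h ≤
      restrictedDim w0 w1 m k n h * restrictedDim w0 w1 m 0 n h' := by
  induction n, hmn using Nat.le_induction generalizing h h' with
  | base =>
    rw [restrictedDim_self w0 w1 m k h, restrictedDim_self w0 w1 m k h']
    have := mul_nonneg (restrictedDim_nonneg hw0 hw1 m 0 m h)
      (restrictedDim_nonneg hw0 hw1 m 0 m h')
    split_ifs
    · rw [mul_comm]
    · omega
    · simpa using this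
    · simp
  | succ n hmn ih =>
    obtain rfl | hlt := hh.eq_or_lt
    · rfl
    obtain ⟨h, rfl⟩ : ∃ j, h = j + 1 := ⟨h - 1, by omega⟩
    simp only [restrictedDim_succ_succ _ _ _ _ hmn]
    cases h' with
    | zero =>
      simp only [restrictedDim_succ_zero _ _ _ hmn]
      have h1 := mul_le_mul_of_nonneg_right (ih (Nat.zero_le h))
        (mul_nonneg (hw0 (0, n)) (hw1 (h, n - h)))
      have h2 := mul_le_mul_of_nonneg_right (ih (Nat.zero_le (h + 1)))
        (mul_nonneg (hw0 (0, n)) (hw0 (h + 1, n - (h + 1))))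
      linear_combination h1 + h2
    | succ g =>
      simp only [restrictedDim_succ_succ _ _ _ _ hmn]
      have h1 := mul_le_mul_of_nonneg_right (ih (show g ≤ h by omega))
        (mul_nonneg (hw1 (g, n - g)) (hw1 (h, n - h)))
      have h2 := mul_le_mul_of_nonneg_right (ih (show g ≤ h + 1 by omega))
        (mul_nonneg (hw1 (g, n - g)) (hw0 (h + 1, n - (h + 1))))
      have h3 := mul_le_mul_of_nonneg_right (ih (show g + 1 ≤ h by omega))
        (mul_nonneg (hw0 (g + 1, n - (g + 1))) (hw1 (h, n - h)))
      have h4 := mul_le_mul_of_nonneg_right (ih (show g + 1 ≤ h + 1 by omega))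
        (mul_nonneg (hw0 (g + 1, n - (g + 1))) (hw0 (h + 1, n - (h + 1))))
      linear_combination h1 + h2 + h3 + h4

/-- The elementary measure at the higher endpoint `(h, n-h)` stochastically dominates the one at
`(h', n-h')`, in the number of heads among the first `m` steps. -/
theorem elementary_measure_stochastic_dominance
    (w0 w1 : ℕ × ℕ → ℝ) (hw0 : ∀ p, 0 < w0 p) (hw1 : ∀ p, 0 < w1 p)
    (n h h' m k : ℕ) (hn : 1 ≤ n) (hh'h : h' ≤ h) (hhn : h ≤ n) (hm1 : 1 ≤ m) (hmn : m ≤ n) :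
    (∑ γ ∈ (Finset.univ : Finset (Fin n → Bool)).filter
          (fun γ => headsUpTo γ n = h ∧ k ≤ headsUpTo γ m), pathWeight w0 w1 γ)
        * dim w0 w1 h' (n - h')
      ≥ (∑ γ ∈ (Finset.univ : Finset (Fin n → Bool)).filter
          (fun γ => headsUpTo γ n = h' ∧ k ≤ headsUpTo γ m), pathWeight w0 w1 γ)
        * dim w0 w1 h (n - h) := by
  rw [dim_eq_restrictedDim w0 w1 m hhn, dim_eq_restrictedDim w0 w1 m (hh'h.trans hhn)]
  exact restrictedDim_mul_le (fun p => (hw0 p).le) (fun p => (hw1 p).le) m k hmn hh'h
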